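/- arXiv:1210.7375 — 2 statements merged into one kernel-verified Lean document; each statement's English description precedes it below -/
import Mathlib

section
/- For each n ∈ ℕ let N_n ∈ ℕ and p_n ∈ (0,1) with N_n·p_n → ∞ and limsup_n p_n < 1, and let X_n be Binomial(N_n, p_n). Define β̂_n = log( X_n / (N_n − X_n) ) when 0 < X_n < N_n (and β̂_n = 0 otherwise), and β_n = log( p_n/(1−p_n) ). Then the law of √(N_n · p_n · (1−p_n)) · (β̂_n − β_n) converges weakly to the standard Gaussian measure on ℝ. -/
open Filter MeasureTheory

theorem norm_pow_sub_pow_le {z w : ℂ} (hz : ‖z‖ ≤ 1) (hw : ‖w‖ ≤ 1) (n : ℕ) :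
    ‖z ^ n - w ^ n‖ ≤ n * ‖z - w‖ := by
  induction n with
  | zero => simp
  | succ n ih =>
    have h : z ^ (n + 1) - w ^ (n + 1) = z ^ n * (z - w) + (z ^ n - w ^ n) * w := by ring
    calc ‖z ^ (n + 1) - w ^ (n + 1)‖ ≤ ‖z‖ ^ n * ‖z - w‖ + ‖z ^ n - w ^ n‖ * ‖w‖ := by
          rw [h, ← norm_pow, ← norm_mul, ← norm_mul]
          exact norm_add_le _ _
      _ ≤ 1 * ‖z - w‖ + (n * ‖z - w‖) * 1 := by
          gcongr
          exact pow_le_one₀ (norm_nonneg _) hz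
      _ = (n + 1 : ℕ) * ‖z - w‖ := by push_cast; ring

theorem norm_exp_ofReal_mul_I_sub_le (a b : ℝ) :
    ‖Complex.exp (a * Complex.I) - Complex.exp (b * Complex.I)‖ ≤ |a - b| := by
  have h : Complex.exp (a * Complex.I) - Complex.exp (b * Complex.I) =
      Complex.exp (b * Complex.I) * (Complex.exp (Complex.I * (a - b : ℝ)) - 1) := by
    rw [mul_sub, ← Complex.exp_add]
    push_cast
    ring_nf
  rw [h, norm_mul, Complex.norm_exp_ofReal_mul_I, one_mul]
  exact Real.norm_exp_I_mul_ofReal_sub_one_le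

theorem norm_exp_ofReal_mul_I_sub_taylor_le {x : ℝ} (hx : |x| ≤ 1) :
    ‖Complex.exp (x * Complex.I) - (1 + x * Complex.I - x ^ 2 / 2)‖ ≤ |x| ^ 3 := by
  have hn : ‖(x * Complex.I : ℂ)‖ = |x| := by simp
  have h := Complex.exp_bound (x := x * Complex.I) (by rwa [hn]) (n := 3) (by norm_num)
  rw [hn] at h
  have hs : ∑ m ∈ Finset.range 3, (x * Complex.I : ℂ) ^ m / m.factorial =
      1 + x * Complex.I - x ^ 2 / 2 := by
    simp [Finset.sum_range_succ, mul_pow, Nat.factorial]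
    ring
  rw [hs] at h
  refine h.trans ?_
  norm_num [Nat.factorial]
  have : 0 ≤ |x| ^ 3 := by positivity
  linarith

theorem abs_log_one_add_sub_le {v : ℝ} (hv : |v| ≤ 1 / 2) :
    |Real.log (1 + v) - v| ≤ 2 * v ^ 2 := by
  have h := Real.abs_log_sub_add_sum_range_le (x := -v) (by rw [abs_neg]; linarith) 1
  simp only [Finset.range_one, Finset.sum_singleton, abs_neg, sub_neg_eq_add] at h
  norm_num at h
  rw [neg_add_eq_sub] at h
  refine h.trans ?_
  rw [div_le_iff₀ (by linarith)]
  nlinarith [sq_nonneg v]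

theorem sum_binomial_weight_mul_sq (N : ℕ) (p : ℝ) :
    ∑ x ∈ Finset.range (N + 1), (N.choose x * p ^ x * (1 - p) ^ (N - x)) * (x - N * p) ^ 2 =
      N * p * (1 - p) := by
  have h := congrArg (Polynomial.eval p) (bernsteinPolynomial.variance ℝ N)
  simp only [Polynomial.eval_finsetSum, bernsteinPolynomial, Polynomial.eval_mul,
    Polynomial.eval_pow, Polynomial.eval_sub, nsmul_eq_mul, Polynomial.eval_X,
    Polynomial.eval_natCast, Polynomial.eval_one] at h
  rw [← h]
  refine Finset.sum_congr rfl fun x _ ↦ ?_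
  ring

theorem sum_binomial_weight_mul_cexp (N : ℕ) (p u : ℝ) :
    ∑ x ∈ Finset.range (N + 1), ((N.choose x * p ^ x * (1 - p) ^ (N - x) : ℝ) : ℂ) *
        Complex.exp ((u * (x - N * p) : ℝ) * Complex.I) =
      (p * Complex.exp ((u * (1 - p) : ℝ) * Complex.I) +
        (1 - p : ℝ) * Complex.exp ((-(u * p) : ℝ) * Complex.I)) ^ N := by
  rw [add_pow]
  refine Finset.sum_congr rfl fun x hx ↦ ?_
  have hx' : x ≤ N := Finset.mem_range_succ_iff.1 hx
  rw [mul_pow, mul_pow, ← Complex.exp_nat_mul, ← Complex.exp_nat_mul]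
  have he : Complex.exp ((u * (x - N * p) : ℝ) * Complex.I) =
      Complex.exp (x * ((u * (1 - p) : ℝ) * Complex.I)) *
        Complex.exp ((N - x : ℕ) * ((-(u * p) : ℝ) * Complex.I)) := by
    rw [← Complex.exp_add]
    congr 1
    push_cast [Nat.cast_sub hx']
    ring
  rw [he]
  push_cast
  ring

/-- A quantitative central limit theorem for the characteristic function of a standardized
binomial distribution. -/
theorem norm_sum_binomial_weight_mul_cexp_sub_le {N : ℕ} {p s : ℝ} (hp0 : 0 < p) (hp1 : p < 1)
    (hs : 0 < s) (hs2 : s ^ 2 = N * p * (1 - p)) {t : ℝ} (ht : |t| ≤ s) :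
    ‖∑ x ∈ Finset.range (N + 1), ((N.choose x * p ^ x * (1 - p) ^ (N - x) : ℝ) : ℂ) *
        Complex.exp ((t * ((x - N * p) / s) : ℝ) * Complex.I) - Complex.exp (-t ^ 2 / 2)‖ ≤
      |t| ^ 3 / s + |t| ^ 4 / s ^ 2 := by
  have hN : 0 < (N : ℝ) := by
    rcases Nat.eq_zero_or_pos N with rfl | h
    · simp at hs2; exact absurd hs2 hs.ne'
    · exact_mod_cast h
  have hq : 0 < 1 - p := by linarith
  have hsN : s ^ 2 ≤ N := by
    rw [hs2]
    have : p * (1 - p) ≤ 1 := by nlinarith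
    nlinarith
  set u := t / s with hu
  have hu1 : |u| ≤ 1 := by
    rw [hu, abs_div, abs_of_pos hs]
    exact (div_le_one hs).2 ht
  have hut : ∀ x : ℕ, t * ((x - N * p) / s) = u * (x - N * p) := fun x ↦ by
    rw [hu]; ring
  simp_rw [hut]
  rw [sum_binomial_weight_mul_cexp]
  set z : ℂ := p * Complex.exp ((u * (1 - p) : ℝ) * Complex.I) +
        (1 - p : ℝ) * Complex.exp ((-(u * p) : ℝ) * Complex.I) with hzdef
  set r : ℝ := -(t ^ 2 / (2 * N)) with hr
  have hw : Complex.exp (-t ^ 2 / 2) = Complex.exp (r : ℂ) ^ N := by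
    rw [← Complex.exp_nat_mul, hr]
    congr 1
    have : (N : ℂ) ≠ 0 := by exact_mod_cast hN.ne'
    push_cast
    field_simp
  have hr0 : r ≤ 0 := by rw [hr]; simp; positivity
  have hrabs : |r| = |t| ^ 2 / (2 * N) := by
    rw [abs_of_nonpos hr0, hr, sq_abs]; ring
  have ht2 : |t| ^ 2 ≤ N := (pow_le_pow_left₀ (abs_nonneg _) ht 2).trans hsN
  have hr1 : |r| ≤ 1 := by
    rw [hrabs, div_le_one (by positivity)]; linarith
  have hz1 : ‖z‖ ≤ 1 := by
    refine (norm_add_le _ _).trans ?_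
    rw [norm_mul, norm_mul, Complex.norm_exp_ofReal_mul_I, Complex.norm_exp_ofReal_mul_I,
      Complex.norm_real, Complex.norm_real, Real.norm_of_nonneg hp0.le, Real.norm_of_nonneg hq.le]
    linarith
  have hw1 : ‖Complex.exp (r : ℂ)‖ ≤ 1 := by
    rw [Complex.norm_exp]; simpa using hr0
  have hur : u ^ 2 * (p * (1 - p)) / 2 = -r := by
    rw [hu, hr, div_pow, hs2]
    field_simp
  have hA : ‖z - (1 + r)‖ ≤ |u| ^ 3 * (p * (1 - p)) := by
    have h1 : |u * (1 - p)| ≤ 1 := by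
      rw [abs_mul, abs_of_pos hq]; nlinarith [abs_nonneg u]
    have h2 : |-(u * p)| ≤ 1 := by
      rw [abs_neg, abs_mul, abs_of_pos hp0]; nlinarith [abs_nonneg u]
    have h1' := norm_exp_ofReal_mul_I_sub_taylor_le h1
    have h2' := norm_exp_ofReal_mul_I_sub_taylor_le h2
    have hr' : (r : ℂ) = -(u ^ 2 * (p * (1 - p)) / 2) := by
      have : r = -(u ^ 2 * (p * (1 - p)) / 2) := by linarith
      rw [this]; push_cast; ring
    have hz' : z - (1 + r) =
        p * (Complex.exp ((u * (1 - p) : ℝ) * Complex.I) -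
          (1 + (u * (1 - p) : ℝ) * Complex.I - ((u * (1 - p) : ℝ) : ℂ) ^ 2 / 2)) +
        (1 - p : ℝ) * (Complex.exp ((-(u * p) : ℝ) * Complex.I) -
          (1 + (-(u * p) : ℝ) * Complex.I - ((-(u * p) : ℝ) : ℂ) ^ 2 / 2)) := by
      rw [hzdef, hr']; push_cast; ring
    rw [hz']
    refine (norm_add_le _ _).trans ?_
    rw [norm_mul, norm_mul, Complex.norm_real, Complex.norm_real, Real.norm_of_nonneg hp0.le,
      Real.norm_of_nonneg hq.le]
    calc _ ≤ p * |u * (1 - p)| ^ 3 + (1 - p) * |-(u * p)| ^ 3 := by gcongr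
      _ = |u| ^ 3 * (p * (1 - p)) * ((1 - p) ^ 2 + p ^ 2) := by
        rw [abs_neg, abs_mul, abs_mul, abs_of_pos hq, abs_of_pos hp0]; ring
      _ ≤ |u| ^ 3 * (p * (1 - p)) * 1 := by
        gcongr
        nlinarith
      _ = _ := mul_one _
  have hB : ‖Complex.exp (r : ℂ) - (1 + r)‖ ≤ |r| ^ 2 := by
    have h := Complex.norm_exp_sub_one_sub_id_le (x := (r : ℂ)) (by simpa using hr1)
    rw [sub_sub] at h
    simpa using h
  rw [hw]
  calc ‖z ^ N - Complex.exp (r : ℂ) ^ N‖ ≤ N * ‖z - Complex.exp (r : ℂ)‖ :=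
        norm_pow_sub_pow_le hz1 hw1 N
    _ ≤ N * (|u| ^ 3 * (p * (1 - p)) + |r| ^ 2) := by
        gcongr
        calc _ = ‖(z - (1 + r)) - (Complex.exp (r : ℂ) - (1 + r))‖ := by congr 1; ring
          _ ≤ _ := (norm_sub_le _ _).trans (add_le_add hA hB)
    _ = |t| ^ 3 / s + |t| ^ 4 / (4 * N) := by
        have h3 : N * (|u| ^ 3 * (p * (1 - p))) = |t| ^ 3 / s := by
          calc _ = |u| ^ 3 * (N * p * (1 - p)) := by ring
            _ = _ := by
              rw [← hs2, hu, abs_div, abs_of_pos hs]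
              field_simp
        rw [mul_add, h3, hrabs]
        field_simp
        ring
    _ ≤ _ := by
        gcongr
        linarith

theorem abs_mul_log_odds_sub_le {N p s x : ℝ} (hp0 : 0 < p) (hp1 : p < 1)
    (hs : 0 < s) (hs2 : s ^ 2 = N * p * (1 - p)) (hx : |(x - N * p) / s| ≤ s / 2) :
    (0 < x ∧ x < N) ∧
      |s * (Real.log (x / (N - x)) - Real.log (p / (1 - p))) - (x - N * p) / s| ≤
        2 * ((x - N * p) / s) ^ 2 / s := by
  have hq : 0 < 1 - p := by linarith
  have hN : 0 < N := by
    by_contra! h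
    have : N * (p * (1 - p)) ≤ 0 := mul_nonpos_of_nonpos_of_nonneg h (by positivity)
    nlinarith
  set y := (x - N * p) / s with hy
  have hys : |y / s| ≤ 1 / 2 := by
    rw [abs_div, abs_of_pos hs, div_le_iff₀ hs]; linarith
  have hv : |(1 - p) * (y / s)| ≤ 1 / 2 := by
    rw [abs_mul, abs_of_pos hq]; nlinarith [abs_nonneg (y / s)]
  have hw : |-(p * (y / s))| ≤ 1 / 2 := by
    rw [abs_neg, abs_mul, abs_of_pos hp0]; nlinarith [abs_nonneg (y / s)]
  have hyx : y / s * (N * p * (1 - p)) = x - N * p := by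
    rw [← hs2, hy]; field_simp
  have hxv : x = N * p * (1 + (1 - p) * (y / s)) := by linarith
  have hxw : N - x = N * (1 - p) * (1 + -(p * (y / s))) := by linarith
  have hv0 : 0 < 1 + (1 - p) * (y / s) := by linarith [(abs_le.1 hv).1]
  have hw0 : 0 < 1 + -(p * (y / s)) := by linarith [(abs_le.1 hw).1]
  have hx0 : 0 < x := by rw [hxv]; positivity
  have hxN : 0 < N - x := by rw [hxw]; positivity
  refine ⟨⟨hx0, by linarith⟩, ?_⟩
  have hlog : Real.log (x / (N - x)) - Real.log (p / (1 - p)) =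
      Real.log (1 + (1 - p) * (y / s)) - Real.log (1 + -(p * (y / s))) := by
    rw [Real.log_div hx0.ne' hxN.ne', Real.log_div hp0.ne' hq.ne', hxw]
    nth_rw 1 [hxv]
    rw [Real.log_mul (by positivity) hv0.ne', Real.log_mul (by positivity) hw0.ne',
      Real.log_mul hN.ne' hp0.ne', Real.log_mul hN.ne' hq.ne']
    ring
  have h1 := abs_log_one_add_sub_le hv
  have h2 := abs_log_one_add_sub_le hw
  have hsplit : s * (Real.log (1 + (1 - p) * (y / s)) - Real.log (1 + -(p * (y / s)))) - y =
      s * ((Real.log (1 + (1 - p) * (y / s)) - (1 - p) * (y / s)) -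
        (Real.log (1 + -(p * (y / s))) - -(p * (y / s)))) := by
    field_simp
    ring
  rw [hlog, hsplit, abs_mul, abs_of_pos hs]
  calc _ ≤ s * (2 * ((1 - p) * (y / s)) ^ 2 + 2 * (-(p * (y / s))) ^ 2) := by
        gcongr
        exact (abs_sub _ _).trans (add_le_add h1 h2)
    _ = 2 * y ^ 2 / s * ((1 - p) ^ 2 + p ^ 2) := by field_simp
    _ ≤ 2 * y ^ 2 / s * 1 := by
        gcongr
        nlinarith
    _ = _ := mul_one _

theorem norm_sum_binomial_weight_mul_cexp_log_odds_sub_le {N : ℕ} {p s : ℝ} (hp0 : 0 < p)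
    (hp1 : p < 1) (hs : 0 < s) (hs2 : s ^ 2 = N * p * (1 - p)) {b : ℕ → ℝ}
    (hb : ∀ x : ℕ, 0 < x ∧ x < N → b x = Real.log (x / (N - x))) (t : ℝ) :
    ‖∑ x ∈ Finset.range (N + 1), ((N.choose x * p ^ x * (1 - p) ^ (N - x) : ℝ) : ℂ) *
        Complex.exp ((t * (s * (b x - Real.log (p / (1 - p)))) : ℝ) * Complex.I) -
      ∑ x ∈ Finset.range (N + 1), ((N.choose x * p ^ x * (1 - p) ^ (N - x) : ℝ) : ℂ) *
        Complex.exp ((t * ((x - N * p) / s) : ℝ) * Complex.I)‖ ≤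
      2 * |t| / s + 8 / s ^ 2 := by
  have hq : 0 < 1 - p := by linarith
  have hpt : ∀ x : ℕ,
      ‖Complex.exp ((t * (s * (b x - Real.log (p / (1 - p)))) : ℝ) * Complex.I) -
        Complex.exp ((t * ((x - N * p) / s) : ℝ) * Complex.I)‖ ≤
      (2 * |t| / s + 8 / s ^ 2) * ((x - N * p) / s) ^ 2 := fun x ↦ by
    rcases le_or_gt |(x - N * p) / s| (s / 2) with hx | hx
    · obtain ⟨⟨h0, hN⟩, h⟩ := abs_mul_log_odds_sub_le hp0 hp1 hs hs2 hx
      rw [hb x ⟨by exact_mod_cast h0, by exact_mod_cast hN⟩]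
      refine (norm_exp_ofReal_mul_I_sub_le _ _).trans ?_
      rw [← mul_sub, abs_mul]
      calc _ ≤ |t| * (2 * ((x - N * p) / s) ^ 2 / s) := by gcongr
        _ = 2 * |t| / s * ((x - N * p) / s) ^ 2 := by ring
        _ ≤ _ := by
          gcongr
          have : 0 ≤ 8 / s ^ 2 := by positivity
          linarith
    · refine (norm_sub_le _ _).trans ?_
      rw [Complex.norm_exp_ofReal_mul_I, Complex.norm_exp_ofReal_mul_I]
      have hx2 : (s / 2) ^ 2 ≤ ((x - N * p) / s) ^ 2 := by
        rw [← sq_abs ((x - N * p) / s)]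
        exact pow_le_pow_left₀ (by positivity) hx.le 2
      calc (1 : ℝ) + 1 = 8 / s ^ 2 * (s / 2) ^ 2 := by field_simp; norm_num
        _ ≤ 8 / s ^ 2 * ((x - N * p) / s) ^ 2 := by gcongr
        _ ≤ _ := by
          gcongr
          have : 0 ≤ 2 * |t| / s := by positivity
          linarith
  rw [← Finset.sum_sub_distrib]
  calc _ ≤ ∑ x ∈ Finset.range (N + 1), (N.choose x * p ^ x * (1 - p) ^ (N - x)) *
        ((2 * |t| / s + 8 / s ^ 2) * ((x - N * p) / s) ^ 2) := by
        refine norm_sum_le_of_le _ fun x _ ↦ ?_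
        rw [← mul_sub, norm_mul, Complex.norm_real, Real.norm_of_nonneg (by positivity)]
        exact mul_le_mul_of_nonneg_left (hpt x) (by positivity)
    _ = (2 * |t| / s + 8 / s ^ 2) / s ^ 2 * ∑ x ∈ Finset.range (N + 1),
        (N.choose x * p ^ x * (1 - p) ^ (N - x)) * (x - N * p) ^ 2 := by
        rw [Finset.mul_sum]
        refine Finset.sum_congr rfl fun x _ ↦ ?_
        rw [div_pow]
        ring
    _ = _ := by
        rw [sum_binomial_weight_mul_sq, ← hs2]
        field_simp

open ProbabilityTheory in
theorem integral_map_binomial {E : Type*} [NormedAddCommGroup E] [NormedSpace ℝ E]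
    [CompleteSpace E] (N : ℕ) (p : unitInterval) (T : ℕ → ℝ) {f : ℝ → E} (hf : Continuous f) :
    ∫ y, f y ∂((binomial N p).map T) =
      ∑ x ∈ Finset.range (N + 1), (N.choose x * (p : ℝ) ^ x * (1 - p) ^ (N - x)) • f (T x) := by
  have hT : AEMeasurable T (binomial N p) := Measurable.of_discrete.aemeasurable
  have hfm : AEStronglyMeasurable f ((binomial N p).map T) :=
    hf.stronglyMeasurable.aestronglyMeasurable
  rw [integral_map hT hfm, integral_binomial]
  refine Finset.sum_congr ?_ fun _ _ ↦ rfl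
  ext
  simp

/-- Asymptotic normality of the log-odds estimator for a binomial.
If `X_n ~ Binomial(N_n, p_n)` with `N_n p_n → ∞` and `limsup p_n < 1`, then
`√(N_n p_n (1−p_n))·(β̂_n − β_n)` converges in distribution to the standard
Gaussian, where `β̂_n = log(X_n/(N_n−X_n))` and `β_n = log(p_n/(1−p_n))`
(weak convergence tested against every bounded continuous function). -/
theorem stmt_6 (N : ℕ → ℕ) (p : ℕ → ℝ)
    (hp0 : ∀ n, 0 < p n) (hp1 : ∀ n, p n < 1)
    (hNp : Tendsto (fun n => (N n : ℝ) * p n) atTop atTop)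
    (hlimsup : Filter.limsup p atTop < 1)
    (bhat : ℕ → ℕ → ℝ)
    (hbhat : ∀ n x, bhat n x =
      if 0 < x ∧ x < N n then Real.log ((x : ℝ) / ((N n : ℝ) - (x : ℝ))) else 0)
    (βn : ℕ → ℝ) (hβ : ∀ n, βn n = Real.log (p n / (1 - p n))) :
    ∀ f : ℝ → ℝ, Continuous f → (∃ C : ℝ, ∀ x, |f x| ≤ C) →
      Tendsto (fun n => ∑ x ∈ Finset.range (N n + 1),
          (((N n).choose x : ℝ) * p n ^ x * (1 - p n) ^ (N n - x)) *
            f (Real.sqrt ((N n : ℝ) * p n * (1 - p n)) * (bhat n x - βn n)))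
        atTop (nhds (∫ x, f x ∂(ProbabilityTheory.gaussianReal 0 1))) := by
  intro f hf ⟨C, hC⟩
  set s : ℕ → ℝ := fun n ↦ Real.sqrt ((N n : ℝ) * p n * (1 - p n)) with hs
  have hs2 : ∀ n, s n ^ 2 = N n * p n * (1 - p n) := fun n ↦
    Real.sq_sqrt (mul_nonneg (mul_nonneg (Nat.cast_nonneg _) (hp0 n).le) (by linarith [hp1 n]))
  have hs_top : Tendsto s atTop atTop := by
    obtain ⟨c, hc, hc1⟩ := exists_between hlimsup
    have hbdd : IsBoundedUnder (· ≤ ·) atTop p := isBoundedUnder_of ⟨1, fun n ↦ (hp1 n).le⟩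
    refine Real.tendsto_sqrt_atTop.comp (tendsto_atTop_mono' _ ?_
      (hNp.atTop_mul_const (sub_pos.2 hc1)))
    filter_upwards [eventually_lt_of_limsup_lt hc hbdd] with n hn
    have := mul_nonneg (Nat.cast_nonneg (α := ℝ) (N n)) (hp0 n).le
    gcongr
  let P : ℕ → unitInterval := fun n ↦ ⟨p n, (hp0 n).le, (hp1 n).le⟩
  let T : ℕ → ℕ → ℝ := fun n x ↦ s n * (bhat n x - βn n)
  let μ : ℕ → ProbabilityMeasure ℝ := fun n ↦
    ⟨(ProbabilityTheory.binomial (N n) (P n)).map (T n),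
      Measure.isProbabilityMeasure_map Measurable.of_discrete.aemeasurable⟩
  let γ : ProbabilityMeasure ℝ := ⟨ProbabilityTheory.gaussianReal 0 1, inferInstance⟩
  have hweak : Tendsto μ atTop (nhds γ) := by
    refine ProbabilityMeasure.tendsto_iff_tendsto_charFun.2 fun t ↦ ?_
    have hγ : charFun (γ : Measure ℝ) t = Complex.exp (-t ^ 2 / 2) := by
      simp [γ, ProbabilityTheory.charFun_gaussianReal, neg_div]
    have hμ : ∀ n, charFun (μ n : Measure ℝ) t = ∑ x ∈ Finset.range (N n + 1),
        (((N n).choose x * p n ^ x * (1 - p n) ^ (N n - x) : ℝ) : ℂ) *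
          Complex.exp ((t * (s n * (bhat n x - Real.log (p n / (1 - p n)))) : ℝ) *
            Complex.I) := fun n ↦ by
      rw [charFun_apply_real]
      refine (integral_map_binomial (N n) (P n) (T n) (by fun_prop)).trans ?_
      refine Finset.sum_congr rfl fun x _ ↦ ?_
      simp only [P, T, hβ, Complex.real_smul, Complex.ofReal_mul]
    rw [hγ, tendsto_iff_norm_sub_tendsto_zero]
    have hlim : Tendsto (fun n ↦ (2 * |t| / s n + 8 / s n ^ 2) +
        (|t| ^ 3 / s n + |t| ^ 4 / s n ^ 2)) atTop (nhds 0) := by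
      have hsq : Tendsto (fun n ↦ s n ^ 2) atTop atTop :=
        (tendsto_pow_atTop two_ne_zero).comp hs_top
      simpa using ((hs_top.const_div_atTop (2 * |t|)).add (hsq.const_div_atTop 8)).add
        ((hs_top.const_div_atTop (|t| ^ 3)).add (hsq.const_div_atTop (|t| ^ 4)))
    refine squeeze_zero' (.of_forall fun _ ↦ norm_nonneg _) ?_ hlim
    filter_upwards [hs_top.eventually_gt_atTop 0, hs_top.eventually_ge_atTop |t|] with n hn hnt
    rw [hμ]
    refine (norm_sub_le_norm_sub_add_norm_sub _ _ _).trans (add_le_add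
      (norm_sum_binomial_weight_mul_cexp_log_odds_sub_le (hp0 n) (hp1 n) hn (hs2 n)
        (fun x hx ↦ by rw [hbhat, if_pos hx]) t)
      (norm_sum_binomial_weight_mul_cexp_sub_le (hp0 n) (hp1 n) hn (hs2 n) hnt))
  have h := ProbabilityMeasure.tendsto_iff_forall_integral_tendsto.1 hweak
    (BoundedContinuousFunction.ofNormedAddCommGroup f hf C hC)
  refine h.congr fun n ↦ ?_
  exact integral_map_binomial (N n) (P n) (T n) hf
end

section
/- Consider the links-and-triangles SUGM on n nodes with parameters p_T^n, p_L^n ∈ (0,1): for each 3-element subset T of {1,…,n}, an independent Bernoulli(p_T^n) indicator Y_T, and for each 2-element subset e, an independent Bernoulli(p_L^n) indicator Z_e, all mutually independent; the random graph g has edge e if and only if Z_e = 1 or Y_T = 1 for some triple T containing e. Let L_T(g) be the number of edges of g contained in some 3-clique of g, and S_U(g) the number of edges of g not contained in any 3-clique of g. Assume relative sparsity and growth: n^{3/2}·p_T^n → 0, n^{1/2}·p_L^n → 0, (p_L^n)³ / p_T^n → 0, binom(n,3)·p_T^n → ∞, and n²·p_L^n → ∞ as n → ∞. Then the direct count estimator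 p̂_L^n = S_U(g) / ( binom(n,2) − L_T(g) ) is ratio consistent: p̂_L^n / p_L^n → 1 in probability. -/
open Filter

/-- The 3-element subsets of `{1,…,n}` (potential triangles). -/
abbrev Triples (n : ℕ) : Finset (Finset (Fin n)) :=
  (Finset.univ : Finset (Fin n)).powersetCard 3

/-- The 2-element subsets of `{1,…,n}` (potential links). -/
abbrev Pairs (n : ℕ) : Finset (Finset (Fin n)) :=
  (Finset.univ : Finset (Fin n)).powersetCard 2

/-- Sample space of the links-and-triangles SUGM: a Bernoulli indicator for each
potential triangle and each potential link. -/
abbrev SugmOmega (n : ℕ) : Type :=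
  (↥(Triples n) → Bool) × (↥(Pairs n) → Bool)

/-- Probability weight of an outcome: all triangle indicators are independent
Bernoulli(`pT`) and all link indicators independent Bernoulli(`pL`),
all mutually independent. -/
noncomputable def sugmWt (n : ℕ) (pT pL : ℝ) (ω : SugmOmega n) : ℝ :=
  (∏ T : ↥(Triples n), if ω.1 T then pT else 1 - pT) *
    ∏ e : ↥(Pairs n), if ω.2 e then pL else 1 - pL

/-- The observed graph `g` has edge `e` iff the link indicator of `e` is on or some
truly generated triangle contains `e`. -/
def sugmEdge (n : ℕ) (ω : SugmOmega n) (e : ↥(Pairs n)) : Prop :=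
  ω.2 e = true ∨ ∃ T : ↥(Triples n),
    ω.1 T = true ∧ (e : Finset (Fin n)) ⊆ (T : Finset (Fin n))

/-- A triple of vertices is a 3-clique of the observed graph iff all pairs of its
vertices are edges of the observed graph. -/
def sugmTriangle (n : ℕ) (ω : SugmOmega n) (T : ↥(Triples n)) : Prop :=
  ∀ e : ↥(Pairs n), (e : Finset (Fin n)) ⊆ (T : Finset (Fin n)) → sugmEdge n ω e

open scoped Classical in
/-- `L_T(g)`: the number of edges of the observed graph contained in some 3-clique
of the observed graph. -/
noncomputable def supportedCount (n : ℕ) (ω : SugmOmega n) : ℕ :=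
  (Finset.univ.filter (fun e : ↥(Pairs n) => sugmEdge n ω e ∧
    ∃ T : ↥(Triples n), (e : Finset (Fin n)) ⊆ (T : Finset (Fin n)) ∧
      sugmTriangle n ω T)).card

open scoped Classical in
/-- `S_U(g)`: the number of edges of the observed graph not contained in any
3-clique of the observed graph (unsupported links). -/
noncomputable def unsupportedCount (n : ℕ) (ω : SugmOmega n) : ℕ :=
  (Finset.univ.filter (fun e : ↥(Pairs n) => sugmEdge n ω e ∧
    ¬ ∃ T : ↥(Triples n), (e : Finset (Fin n)) ⊆ (T : Finset (Fin n)) ∧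
      sugmTriangle n ω T)).card

/-- The independent coordinates of the model: potential triangles and potential links. -/
abbrev SugmIndex (n : ℕ) : Type := ↥(Triples n) ⊕ ↥(Pairs n)

/-- The success probability of each coordinate. -/
def sugmProb (n : ℕ) (pT pL : ℝ) : SugmIndex n → ℝ := Sum.elim (fun _ => pT) (fun _ => pL)

/-- The indicator that a coordinate is switched on. -/
def sugmInd {n : ℕ} (ω : SugmOmega n) (i : SugmIndex n) : ℝ :=
  if Sum.elim ω.1 ω.2 i = true then 1 else 0

/-- Expectation in the links-and-triangles model. -/
noncomputable def sugmExp (n : ℕ) (pT pL : ℝ) (f : SugmOmega n → ℝ) : ℝ :=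
  ∑ ω : SugmOmega n, f ω * sugmWt n pT pL ω

/-- The coordinates whose activation creates the edge `e`. -/
def sugmCauses {n : ℕ} (e : ↥(Pairs n)) : Finset (SugmIndex n) :=
  ((Finset.univ.filter fun T : ↥(Triples n) =>
    (e : Finset (Fin n)) ⊆ (T : Finset (Fin n))).disjSum {e})

section Expectation

variable {n : ℕ} {pT pL : ℝ}

lemma sugmInd_nonneg (ω : SugmOmega n) (i : SugmIndex n) : 0 ≤ sugmInd ω i := by
  unfold sugmInd; split_ifs <;> norm_num

lemma sugmWt_nonneg (hT : pT ∈ Set.Ioo (0 : ℝ) 1) (hL : pL ∈ Set.Ioo (0 : ℝ) 1)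
    (ω : SugmOmega n) : 0 ≤ sugmWt n pT pL ω := by
  unfold sugmWt
  obtain ⟨h1, h2⟩ := hT
  obtain ⟨h3, h4⟩ := hL
  refine mul_nonneg (Finset.prod_nonneg fun i _ => ?_) (Finset.prod_nonneg fun i _ => ?_) <;>
    split_ifs <;> linarith

lemma sugmExp_mono (hT : pT ∈ Set.Ioo (0 : ℝ) 1) (hL : pL ∈ Set.Ioo (0 : ℝ) 1)
    {f g : SugmOmega n → ℝ} (h : ∀ ω, f ω ≤ g ω) :
    sugmExp n pT pL f ≤ sugmExp n pT pL g :=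
  Finset.sum_le_sum fun ω _ => mul_le_mul_of_nonneg_right (h ω) (sugmWt_nonneg hT hL ω)

lemma sugmExp_add (f g : SugmOmega n → ℝ) :
    sugmExp n pT pL (fun ω => f ω + g ω) = sugmExp n pT pL f + sugmExp n pT pL g := by
  simp [sugmExp, add_mul, Finset.sum_add_distrib]

lemma sugmExp_const_mul (c : ℝ) (f : SugmOmega n → ℝ) :
    sugmExp n pT pL (fun ω => c * f ω) = c * sugmExp n pT pL f := by
  simp [sugmExp, Finset.mul_sum, mul_assoc]

lemma sugmExp_sum {ι : Type*} (s : Finset ι) (f : ι → SugmOmega n → ℝ) :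
    sugmExp n pT pL (fun ω => ∑ i ∈ s, f i ω) = ∑ i ∈ s, sugmExp n pT pL (f i) := by
  simp only [sugmExp, Finset.sum_mul]
  exact Finset.sum_comm

/-- Independence: the expectation of a product of distinct indicators factorizes. -/
lemma sugmExp_prod (S : Finset (SugmIndex n)) :
    sugmExp n pT pL (fun ω => ∏ i ∈ S, sugmInd ω i) = ∏ i ∈ S, sugmProb n pT pL i := by
  classical
  have key : ∀ ω : SugmOmega n, (∏ i ∈ S, sugmInd ω i) * sugmWt n pT pL ω =
      ∏ i : SugmIndex n, ((if i ∈ S then (if Sum.elim ω.1 ω.2 i = true then 1 else 0) else 1) *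
        (if Sum.elim ω.1 ω.2 i = true then sugmProb n pT pL i else 1 - sugmProb n pT pL i)) := by
    intro ω
    rw [Finset.prod_mul_distrib]
    congr 1
    · rw [Finset.prod_ite_mem, Finset.univ_inter]; rfl
    · rw [Fintype.prod_sum_type]; rfl
  unfold sugmExp
  simp_rw [key]
  rw [← Equiv.sum_comp (Equiv.sumArrowEquivProdArrow _ _ Bool)]
  have h2 : ∀ w : SugmIndex n → Bool,
      Sum.elim ((Equiv.sumArrowEquivProdArrow _ _ Bool) w).1
        ((Equiv.sumArrowEquivProdArrow _ _ Bool) w).2 = w := by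
    intro w; ext i; cases i <;> rfl
  simp_rw [h2]
  rw [← Fintype.prod_sum (fun (i : SugmIndex n) (b : Bool) =>
    ((if i ∈ S then (if b = true then (1 : ℝ) else 0) else 1) *
        (if b = true then sugmProb n pT pL i else 1 - sugmProb n pT pL i)))]
  rw [← Finset.univ_inter S, ← Finset.prod_ite_mem]
  refine Finset.prod_congr rfl fun i _ => ?_
  by_cases hi : i ∈ S <;> simp [hi]

lemma sugmExp_one : sugmExp n pT pL (fun _ => 1) = 1 := by
  simpa using sugmExp_prod (pT := pT) (pL := pL) (∅ : Finset (SugmIndex n))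

lemma sugmExp_ind (i : SugmIndex n) :
    sugmExp n pT pL (fun ω => sugmInd ω i) = sugmProb n pT pL i := by
  simpa using sugmExp_prod (pT := pT) (pL := pL) {i}

lemma sugmExp_ind_mul {i j : SugmIndex n} (h : i ≠ j) :
    sugmExp n pT pL (fun ω => sugmInd ω i * sugmInd ω j) =
      sugmProb n pT pL i * sugmProb n pT pL j := by
  classical
  simpa [Finset.prod_pair h] using sugmExp_prod (pT := pT) (pL := pL) {i, j}

lemma sugmExp_ind_mul_mul {i j k : SugmIndex n} (hij : i ≠ j) (hik : i ≠ k) (hjk : j ≠ k) :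
    sugmExp n pT pL (fun ω => sugmInd ω i * (sugmInd ω j * sugmInd ω k)) =
      sugmProb n pT pL i * (sugmProb n pT pL j * sugmProb n pT pL k) := by
  classical
  have h : i ∉ ({j, k} : Finset (SugmIndex n)) := by simp [hij, hik]
  simpa [Finset.prod_insert h, Finset.prod_pair hjk] using
    sugmExp_prod (pT := pT) (pL := pL) {i, j, k}

end Expectation

section Graph

variable {n : ℕ} {pT pL : ℝ}

lemma card_triples_superset_le (e : ↥(Pairs n)) :
    (Finset.univ.filter fun T : ↥(Triples n) =>
      (e : Finset (Fin n)) ⊆ (T : Finset (Fin n))).card ≤ n := by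
  classical
  rw [← Finset.card_map (Function.Embedding.subtype _)]
  calc _ ≤ (Finset.univ.image fun v : Fin n => insert v (e : Finset (Fin n))).card := by
        refine Finset.card_le_card fun T hT => ?_
        simp only [Finset.mem_map, Finset.mem_filter, Finset.mem_univ, true_and] at hT
        obtain ⟨T, hsub, rfl⟩ := hT
        have hT3 := (Finset.mem_powersetCard.1 T.2).2
        have he2 := (Finset.mem_powersetCard.1 e.2).2
        have hcard : ((T : Finset (Fin n)) \ e).card = 1 := by
          rw [Finset.card_sdiff_of_subset hsub, hT3, he2]
        obtain ⟨v, hv⟩ := Finset.card_eq_one.1 hcard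
        refine Finset.mem_image.2 ⟨v, Finset.mem_univ _, ?_⟩
        change insert v (e : Finset (Fin n)) = (T : Finset (Fin n))
        rw [← Finset.sdiff_union_of_subset hsub, hv]; rfl
    _ ≤ _ := Finset.card_image_le.trans (by simp)

lemma sum_sugmProb_causes_le (hT : 0 ≤ pT) (e : ↥(Pairs n)) :
    ∑ i ∈ sugmCauses e, sugmProb n pT pL i ≤ pL + n * pT := by
  have h : ((Finset.univ.filter fun T : ↥(Triples n) =>
      (e : Finset (Fin n)) ⊆ (T : Finset (Fin n))).card : ℝ) ≤ n := by
    exact_mod_cast card_triples_superset_le e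
  have h2 := mul_le_mul_of_nonneg_right h hT
  simp only [sugmCauses, Finset.sum_disjSum, sugmProb, Sum.elim_inl, Sum.elim_inr,
    Finset.sum_const, nsmul_eq_mul, Finset.card_singleton, Nat.cast_one, one_mul]
  linarith

lemma sugmEdge_iff (ω : SugmOmega n) (e : ↥(Pairs n)) :
    sugmEdge n ω e ↔ ∃ i ∈ sugmCauses e, sugmInd ω i = 1 := by
  have h : ∀ i, sugmInd ω i = 1 ↔ Sum.elim ω.1 ω.2 i = true := fun i => by simp [sugmInd]
  simp only [h, sugmEdge, sugmCauses, Finset.mem_disjSum, Finset.mem_filter, Finset.mem_univ,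
    true_and, Finset.mem_singleton]
  constructor
  · rintro (he | ⟨T, hT, hs⟩)
    · exact ⟨Sum.inr e, Or.inr ⟨e, rfl, rfl⟩, he⟩
    · exact ⟨Sum.inl T, Or.inl ⟨T, hs, rfl⟩, hT⟩
  · rintro ⟨_, ⟨T, hs, rfl⟩ | ⟨_, rfl, rfl⟩, hon⟩
    · exact Or.inr ⟨T, hon, hs⟩
    · exact Or.inl hon

/-- The two other sides of a triangle. -/
lemma exists_other_sides {e : ↥(Pairs n)} {T : ↥(Triples n)}
    (h : (e : Finset (Fin n)) ⊆ (T : Finset (Fin n))) :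
    ∃ f g : ↥(Pairs n), f ≠ e ∧ g ≠ e ∧ f ≠ g ∧
      (f : Finset (Fin n)) ∪ (g : Finset (Fin n)) = (T : Finset (Fin n)) := by
  classical
  obtain ⟨T, hT⟩ := T
  obtain ⟨e, he⟩ := e
  have hT3 := (Finset.mem_powersetCard.1 hT).2
  have he2 := (Finset.mem_powersetCard.1 he).2
  obtain ⟨a, b, hab, rfl⟩ := Finset.card_eq_two.1 he2
  have hcard : (T \ {a, b}).card = 1 := by
    rw [Finset.card_sdiff_of_subset h, hT3, he2]
  obtain ⟨c, hc⟩ := Finset.card_eq_one.1 hcard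
  have hcm : c ∈ T \ {a, b} := by rw [hc]; simp
  simp only [Finset.mem_sdiff, Finset.mem_insert, Finset.mem_singleton, not_or] at hcm
  obtain ⟨-, hca, hcb⟩ := hcm
  have hTe : T = {c} ∪ {a, b} := by rw [← hc, Finset.sdiff_union_of_subset h]
  refine ⟨⟨{a, c}, ?_⟩, ⟨{b, c}, ?_⟩, ?_, ?_, ?_, ?_⟩
  · simp [Finset.card_pair (Ne.symm hca)]
  · simp [Finset.card_pair (Ne.symm hcb)]
  · intro heq
    have : c ∈ ({a, b} : Finset (Fin n)) := by
      rw [← show _ = ({a, b} : Finset (Fin n)) from congrArg Subtype.val heq]; simp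
    simp [hca, hcb] at this
  · intro heq
    have : c ∈ ({a, b} : Finset (Fin n)) := by
      rw [← show _ = ({a, b} : Finset (Fin n)) from congrArg Subtype.val heq]; simp
    simp [hca, hcb] at this
  · intro heq
    have : a ∈ ({b, c} : Finset (Fin n)) := by
      rw [← show _ = ({b, c} : Finset (Fin n)) from congrArg Subtype.val heq]; simp
    simp [hab, Ne.symm hca] at this
  · change ({a, c} : Finset (Fin n)) ∪ {b, c} = T
    rw [hTe]; ext x; simp; tauto

open scoped Classical in
lemma sugmExp_link_triangle_le (hT : pT ∈ Set.Ioo (0 : ℝ) 1) (hL : pL ∈ Set.Ioo (0 : ℝ) 1)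
    {e : ↥(Pairs n)} {T : ↥(Triples n)} (h : (e : Finset (Fin n)) ⊆ (T : Finset (Fin n))) :
    sugmExp n pT pL (fun ω => sugmInd ω (Sum.inr e) * if sugmTriangle n ω T then 1 else 0) ≤
      pL * (pT + (pL + n * pT) ^ 2) := by
  obtain ⟨f, g, hfe, hge, hfg, hun⟩ := exists_other_sides h
  have hq : ∀ i, 0 ≤ sugmProb n pT pL i := by
    rintro (i | i)
    · exact hT.1.le
    · exact hL.1.le
  set F := (sugmCauses f).erase (Sum.inl T) with hF
  set G := (sugmCauses g).erase (Sum.inl T) with hG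
  have hFs : ∑ i ∈ F, sugmProb n pT pL i ≤ pL + n * pT :=
    (Finset.sum_le_sum_of_subset_of_nonneg (Finset.erase_subset _ _) fun i _ _ => hq i).trans
      (sum_sugmProb_causes_le hT.1.le f)
  have hGs : ∑ i ∈ G, sugmProb n pT pL i ≤ pL + n * pT :=
    (Finset.sum_le_sum_of_subset_of_nonneg (Finset.erase_subset _ _) fun i _ _ => hq i).trans
      (sum_sugmProb_causes_le hT.1.le g)
  have hF0 : 0 ≤ ∑ i ∈ F, sugmProb n pT pL i := Finset.sum_nonneg fun i _ => hq i
  have hG0 : 0 ≤ ∑ i ∈ G, sugmProb n pT pL i := Finset.sum_nonneg fun i _ => hq i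
  have hpt : ∀ ω : SugmOmega n,
      (sugmInd ω (Sum.inr e) * if sugmTriangle n ω T then 1 else 0) ≤
        sugmInd ω (Sum.inr e) * sugmInd ω (Sum.inl T) +
          ∑ a ∈ F, ∑ b ∈ G, sugmInd ω (Sum.inr e) * (sugmInd ω a * sugmInd ω b) := by
    intro ω
    have hnn : ∀ a ∈ F, 0 ≤ ∑ b ∈ G, sugmInd ω (Sum.inr e) * (sugmInd ω a * sugmInd ω b) :=
      fun a _ => Finset.sum_nonneg fun b _ => mul_nonneg (sugmInd_nonneg _ _)
        (mul_nonneg (sugmInd_nonneg _ _) (sugmInd_nonneg _ _))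
    have he0 := sugmInd_nonneg ω (Sum.inr e)
    have hT0 := sugmInd_nonneg ω (Sum.inl T)
    by_cases htri : sugmTriangle n ω T
    · rw [if_pos htri]
      by_cases hY : sugmInd ω (Sum.inl T) = 1
      · rw [hY]
        exact le_add_of_nonneg_right (Finset.sum_nonneg hnn)
      · obtain ⟨a, ha, ha1⟩ := (sugmEdge_iff ω f).1
          (htri f (hun ▸ Finset.subset_union_left))
        obtain ⟨b, hb, hb1⟩ := (sugmEdge_iff ω g).1
          (htri g (hun ▸ Finset.subset_union_right))
        have haF : a ∈ F := Finset.mem_erase.2 ⟨fun h => hY (h ▸ ha1), ha⟩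
        have hbG : b ∈ G := Finset.mem_erase.2 ⟨fun h => hY (h ▸ hb1), hb⟩
        have h1 := Finset.single_le_sum hnn haF
        have h2 := Finset.single_le_sum (f := fun b =>
          sugmInd ω (Sum.inr e) * (sugmInd ω a * sugmInd ω b))
          (fun b _ => mul_nonneg he0 (mul_nonneg (sugmInd_nonneg _ _) (sugmInd_nonneg _ _))) hbG
        simp only [ha1, hb1, mul_one] at h1 h2
        have := mul_nonneg he0 hT0
        linarith
    · rw [if_neg htri, mul_zero]
      exact add_nonneg (mul_nonneg he0 hT0) (Finset.sum_nonneg hnn)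
  refine (sugmExp_mono hT hL hpt).trans ?_
  rw [sugmExp_add, sugmExp_ind_mul (by simp), sugmExp_sum]
  have hterm : ∀ a ∈ F, ∀ b ∈ G,
      sugmExp n pT pL (fun ω => sugmInd ω (Sum.inr e) * (sugmInd ω a * sugmInd ω b)) =
        pL * (sugmProb n pT pL a * sugmProb n pT pL b) := by
    intro a ha b hb
    rw [hF, Finset.mem_erase, sugmCauses, Finset.mem_disjSum] at ha
    rw [hG, Finset.mem_erase, sugmCauses, Finset.mem_disjSum] at hb
    simp only [Finset.mem_filter, Finset.mem_univ, true_and, Finset.mem_singleton] at ha hb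
    obtain ⟨haT, ha⟩ := ha
    obtain ⟨-, hb⟩ := hb
    refine sugmExp_ind_mul_mul ?_ ?_ ?_
    · rcases ha with ⟨A, -, rfl⟩ | ⟨A, rfl, rfl⟩
      · simp
      · simpa using hfe.symm
    · rcases hb with ⟨A, -, rfl⟩ | ⟨A, rfl, rfl⟩
      · simp
      · simpa using hge.symm
    · rcases ha with ⟨A, hA, rfl⟩ | ⟨A, rfl, rfl⟩ <;> rcases hb with ⟨B, hB, rfl⟩ | ⟨B, rfl, rfl⟩
      · intro hAB
        obtain rfl := Sum.inl_injective hAB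
        refine haT (congrArg Sum.inl (Subtype.ext (Finset.eq_of_subset_of_card_le ?_ ?_).symm))
        · rw [← hun]; exact Finset.union_subset hA hB
        · rw [(Finset.mem_powersetCard.1 A.2).2, (Finset.mem_powersetCard.1 T.2).2]
      · simp
      · simp
      · simpa using hfg
  have hsum : ∑ a ∈ F, sugmExp n pT pL (fun ω => ∑ b ∈ G,
      sugmInd ω (Sum.inr e) * (sugmInd ω a * sugmInd ω b)) =
        pL * ((∑ a ∈ F, sugmProb n pT pL a) * ∑ b ∈ G, sugmProb n pT pL b) := by
    rw [Finset.sum_mul_sum, Finset.mul_sum]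
    refine Finset.sum_congr rfl fun a ha => ?_
    rw [sugmExp_sum, Finset.mul_sum]
    exact Finset.sum_congr rfl fun b hb => hterm a ha b hb
  rw [hsum, mul_add, sq]
  exact add_le_add le_rfl (mul_le_mul_of_nonneg_left
    (mul_le_mul hFs hGs hG0 (hF0.trans hFs)) hL.1.le)

/-- The edge `e` lies in a 3-clique of the observed graph. -/
def sugmSupported (n : ℕ) (ω : SugmOmega n) (e : ↥(Pairs n)) : Prop :=
  ∃ T : ↥(Triples n), (e : Finset (Fin n)) ⊆ (T : Finset (Fin n)) ∧ sugmTriangle n ω T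

/-- The number of truly generated links. -/
def linkCount (n : ℕ) (ω : SugmOmega n) : ℝ := ∑ e : ↥(Pairs n), sugmInd ω (Sum.inr e)

open scoped Classical in
/-- The number of truly generated links lying in some 3-clique of the observed graph. -/
noncomputable def absorbedCount (n : ℕ) (ω : SugmOmega n) : ℝ :=
  ∑ e : ↥(Pairs n), sugmInd ω (Sum.inr e) * if sugmSupported n ω e then 1 else 0

lemma unsupportedCount_eq (ω : SugmOmega n) :
    (unsupportedCount n ω : ℝ) = linkCount n ω - absorbedCount n ω := by
  classical
  rw [unsupportedCount, Finset.card_filter, linkCount, absorbedCount, ← Finset.sum_sub_distrib,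
    Nat.cast_sum]
  refine Finset.sum_congr rfl fun e _ => ?_
  trans ((if sugmEdge n ω e ∧ ¬ sugmSupported n ω e then 1 else 0 : ℕ) : ℝ)
  · congr
  by_cases hs : sugmSupported n ω e
  · simp [hs]
  · have hiff : sugmEdge n ω e ↔ ω.2 e = true := by
      refine ⟨fun h => h.resolve_right ?_, Or.inl⟩
      rintro ⟨T, hT, hsub⟩
      exact hs ⟨T, hsub, fun f hf => Or.inr ⟨T, hT, hf⟩⟩
    by_cases he : ω.2 e = true <;> simp [hs, hiff, he, sugmInd]

lemma absorbedCount_nonneg (ω : SugmOmega n) : 0 ≤ absorbedCount n ω := by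
  classical
  refine Finset.sum_nonneg fun e _ => mul_nonneg (sugmInd_nonneg _ _) ?_
  split_ifs <;> norm_num

lemma card_pairs_univ : (Finset.univ : Finset ↥(Pairs n)).card = n.choose 2 := by
  simp [Finset.card_powersetCard]

lemma sugmExp_linkCount : sugmExp n pT pL (linkCount n) = n.choose 2 * pL := by
  unfold linkCount
  rw [sugmExp_sum]
  simp only [sugmExp_ind, sugmProb, Sum.elim_inr, Finset.sum_const, nsmul_eq_mul,
    card_pairs_univ]

lemma sugmExp_absorbedCount_le (hT : pT ∈ Set.Ioo (0 : ℝ) 1) (hL : pL ∈ Set.Ioo (0 : ℝ) 1) :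
    sugmExp n pT pL (absorbedCount n) ≤
      n.choose 2 * pL * (n * (pT + (pL + n * pT) ^ 2)) := by
  classical
  unfold absorbedCount
  rw [sugmExp_sum]
  have key : ∀ e : ↥(Pairs n), sugmExp n pT pL
      (fun ω => sugmInd ω (Sum.inr e) * if sugmSupported n ω e then 1 else 0) ≤
        n * (pL * (pT + (pL + n * pT) ^ 2)) := by
    intro e
    set K := Finset.univ.filter fun T : ↥(Triples n) =>
      (e : Finset (Fin n)) ⊆ (T : Finset (Fin n)) with hK
    have hpt : ∀ ω : SugmOmega n,
        (sugmInd ω (Sum.inr e) * if sugmSupported n ω e then 1 else 0) ≤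
          ∑ T ∈ K, sugmInd ω (Sum.inr e) * if sugmTriangle n ω T then 1 else 0 := by
      intro ω
      have hnn : ∀ T ∈ K,
          0 ≤ sugmInd ω (Sum.inr e) * if sugmTriangle n ω T then (1 : ℝ) else 0 := fun T _ =>
        mul_nonneg (sugmInd_nonneg _ _) (by split_ifs <;> norm_num)
      by_cases hs : sugmSupported n ω e
      · obtain ⟨T, hsub, htri⟩ := id hs
        have := Finset.single_le_sum hnn (Finset.mem_filter.2 ⟨Finset.mem_univ T, hsub⟩)
        rw [if_pos htri] at this
        rwa [if_pos hs]
      · rw [if_neg hs, mul_zero]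
        exact Finset.sum_nonneg hnn
    refine (sugmExp_mono hT hL hpt).trans ?_
    rw [sugmExp_sum]
    refine (Finset.sum_le_card_nsmul K _ (pL * (pT + (pL + n * pT) ^ 2)) fun T hTK =>
      sugmExp_link_triangle_le hT hL (Finset.mem_filter.1 hTK).2).trans ?_
    rw [nsmul_eq_mul]
    have h0 : 0 ≤ pL * (pT + (pL + n * pT) ^ 2) :=
      mul_nonneg hL.1.le (add_nonneg hT.1.le (sq_nonneg _))
    exact mul_le_mul_of_nonneg_right (by exact_mod_cast card_triples_superset_le e) h0
  refine (Finset.sum_le_card_nsmul _ _ _ fun e _ => key e).trans (le_of_eq ?_)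
  rw [nsmul_eq_mul, card_pairs_univ]
  ring

lemma sugmExp_supportedCount_le (hT : pT ∈ Set.Ioo (0 : ℝ) 1) (hL : pL ∈ Set.Ioo (0 : ℝ) 1) :
    sugmExp n pT pL (fun ω => (supportedCount n ω : ℝ)) ≤ n.choose 2 * (pL + n * pT) := by
  classical
  have hpt : ∀ ω : SugmOmega n, (supportedCount n ω : ℝ) ≤
      ∑ e : ↥(Pairs n), ∑ i ∈ sugmCauses e, sugmInd ω i := by
    intro ω
    rw [supportedCount, Finset.card_filter, Nat.cast_sum]
    refine Finset.sum_le_sum fun e _ => ?_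
    have hnn : ∀ i ∈ sugmCauses e, 0 ≤ sugmInd ω i := fun i _ => sugmInd_nonneg _ _
    split_ifs with h
    · obtain ⟨i, hi, hi1⟩ := (sugmEdge_iff ω e).1 h.1
      have := Finset.single_le_sum hnn hi
      rw [hi1] at this
      simpa using this
    · simpa using Finset.sum_nonneg hnn
  refine (sugmExp_mono hT hL hpt).trans ?_
  rw [sugmExp_sum]
  refine (Finset.sum_le_card_nsmul _ _ (pL + n * pT) fun e _ => ?_).trans (le_of_eq ?_)
  · rw [sugmExp_sum]
    simp only [sugmExp_ind]
    exact sum_sugmProb_causes_le hT.1.le e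
  · rw [nsmul_eq_mul, card_pairs_univ]

/-- The variance of the number of truly generated links is at most its mean. -/
lemma sugmExp_linkCount_sub_sq_le :
    sugmExp n pT pL (fun ω => (linkCount n ω - n.choose 2 * pL) ^ 2) ≤ n.choose 2 * pL := by
  classical
  have hsq : sugmExp n pT pL (fun ω => linkCount n ω * linkCount n ω) ≤
      (n.choose 2 * pL) ^ 2 + n.choose 2 * pL := by
    unfold linkCount
    simp only [Finset.sum_mul_sum, sugmExp_sum]
    have key : ∀ e f : ↥(Pairs n),
        sugmExp n pT pL (fun ω => sugmInd ω (Sum.inr e) * sugmInd ω (Sum.inr f)) ≤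
          pL ^ 2 + if e = f then pL else 0 := by
      intro e f
      by_cases h : e = f
      · subst h
        have : (fun ω : SugmOmega n => sugmInd ω (Sum.inr e) * sugmInd ω (Sum.inr e)) =
            fun ω => sugmInd ω (Sum.inr e) := by
          funext ω; unfold sugmInd; split_ifs <;> norm_num
        rw [this, sugmExp_ind, if_pos rfl]
        simpa [sugmProb] using sq_nonneg pL
      · rw [sugmExp_ind_mul (by simpa using h), if_neg h, add_zero, sq]
        rfl
    refine (Finset.sum_le_sum fun e _ => Finset.sum_le_sum fun f _ => key e f).trans
      (le_of_eq ?_)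
    simp only [Finset.sum_add_distrib, Finset.sum_const, nsmul_eq_mul, card_pairs_univ,
      Finset.sum_ite_eq, Finset.mem_univ, if_true]
    ring
  have hexp : (fun ω : SugmOmega n => (linkCount n ω - n.choose 2 * pL) ^ 2) =
      fun ω => (linkCount n ω * linkCount n ω + (-2 * (n.choose 2 * pL)) * linkCount n ω) +
        (n.choose 2 * pL) ^ 2 * 1 := by
    funext ω; ring
  rw [hexp, sugmExp_add, sugmExp_add, sugmExp_const_mul, sugmExp_const_mul, sugmExp_one,
    sugmExp_linkCount]
  nlinarith

/-- Deterministic step: the estimator is accurate when the links concentrate, few of them are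
absorbed in 3-cliques, and few edges are supported. -/
lemma abs_ratio_sub_one_le {A B L N p δ : ℝ} (hN : 0 < N) (hp : 0 < p) (hδ : 0 < δ)
    (hδ' : δ ≤ 1 / 4) (hB0 : 0 ≤ B) (hL0 : 0 ≤ L) (hA : |A - N * p| ≤ δ * (N * p))
    (hB : B ≤ δ * (N * p)) (hL : L ≤ δ * N) :
    |(A - B) / (N - L) / p - 1| ≤ 4 * δ := by
  obtain ⟨hA1, hA2⟩ := abs_le.1 hA
  have hNp : 0 < N * p := mul_pos hN hp
  have hNL : 0 < N - L := by nlinarith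
  have hLp : L * p ≤ δ * (N * p) := by nlinarith
  have hLp0 : 0 ≤ L * p := mul_nonneg hL0 hp.le
  rw [div_div, abs_le, neg_le_sub_iff_le_add, sub_le_iff_le_add]
  have hpos : 0 < (N - L) * p := mul_pos hNL hp
  constructor
  · have : 1 - 4 * δ ≤ (A - B) / ((N - L) * p) := by
      rw [le_div_iff₀ hpos]
      nlinarith
    linarith
  · rw [div_le_iff₀ hpos]
    nlinarith [mul_nonneg hδ.le hNp.le, mul_nonneg hδ.le (sub_nonneg.2 hLp)]

/-- A quantitative bound on the probability that the estimator is inaccurate. -/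
lemma sugm_deviation_le (hT : pT ∈ Set.Ioo (0 : ℝ) 1) (hL : pL ∈ Set.Ioo (0 : ℝ) 1)
    (hn : 2 ≤ n) {ε δ : ℝ} (hδ : 0 < δ) (hδ' : δ ≤ 1 / 4) (hδε : 4 * δ ≤ ε) :
    ∑ ω : SugmOmega n, Set.indicator {ω' : SugmOmega n |
        ε < |((unsupportedCount n ω' : ℝ) /
          ((n.choose 2 : ℝ) - (supportedCount n ω' : ℝ))) / pL - 1|} (sugmWt n pT pL) ω ≤
      (δ ^ 2 * (n.choose 2 * pL))⁻¹ + δ⁻¹ * (n * (pT + (pL + n * pT) ^ 2)) +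
        δ⁻¹ * (pL + n * pT) := by
  classical
  set N : ℝ := (n.choose 2 : ℝ) with hNdef
  have hN : 0 < N := Nat.cast_pos.2 (Nat.choose_pos hn)
  have hp := hL.1
  have hNp : 0 < N * pL := mul_pos hN hp
  set c₁ := ((δ * (N * pL)) ^ 2)⁻¹ with hc₁
  set c₂ := (δ * (N * pL))⁻¹ with hc₂
  set c₃ := (δ * N)⁻¹ with hc₃
  have h₁ : 0 < c₁ := by positivity
  have h₂ : 0 < c₂ := by positivity
  have h₃ : 0 < c₃ := by positivity
  calc _ ≤ sugmExp n pT pL (fun ω => c₁ * (linkCount n ω - N * pL) ^ 2 +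
          c₂ * absorbedCount n ω + c₃ * (supportedCount n ω : ℝ)) := by
        refine Finset.sum_le_sum fun ω _ => ?_
        have hw := sugmWt_nonneg hT hL ω
        have hB0 := absorbedCount_nonneg ω
        have hS0 : (0 : ℝ) ≤ supportedCount n ω := Nat.cast_nonneg _
        have hx₁ : 0 ≤ c₁ * (linkCount n ω - N * pL) ^ 2 := mul_nonneg h₁.le (sq_nonneg _)
        have hx₂ := mul_nonneg h₂.le hB0
        have hx₃ := mul_nonneg h₃.le hS0
        by_cases hmem : ω ∈ {ω' : SugmOmega n |
            ε < |((unsupportedCount n ω' : ℝ) / (N - (supportedCount n ω' : ℝ))) / pL - 1|}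
        · rw [Set.indicator_of_mem hmem]
          refine le_mul_of_one_le_left hw ?_
          by_contra! hlt
          refine absurd hmem (not_lt.2 (le_trans ?_ hδε))
          rw [unsupportedCount_eq]
          refine abs_ratio_sub_one_le hN hp hδ hδ' hB0 hS0 ?_ ?_ ?_
          · by_contra! hbad
            have h1 : 1 < c₁ * (linkCount n ω - N * pL) ^ 2 := by
              rw [hc₁, ← div_eq_inv_mul, lt_div_iff₀ (by positivity), one_mul,
                ← sq_abs (linkCount n ω - N * pL)]
              exact pow_lt_pow_left₀ hbad (by positivity) two_ne_zero
            linarith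
          · by_contra! hbad
            have h1 : 1 < c₂ * absorbedCount n ω := by
              rwa [hc₂, ← div_eq_inv_mul, lt_div_iff₀ (by positivity), one_mul]
            linarith
          · by_contra! hbad
            have h1 : 1 < c₃ * (supportedCount n ω : ℝ) := by
              rwa [hc₃, ← div_eq_inv_mul, lt_div_iff₀ (by positivity), one_mul]
            linarith
        · rw [Set.indicator_of_notMem hmem]
          exact mul_nonneg (by linarith) hw
    _ = c₁ * sugmExp n pT pL (fun ω => (linkCount n ω - N * pL) ^ 2) +
          c₂ * sugmExp n pT pL (absorbedCount n) +
          c₃ * sugmExp n pT pL (fun ω => (supportedCount n ω : ℝ)) := by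
        rw [sugmExp_add, sugmExp_add, sugmExp_const_mul, sugmExp_const_mul, sugmExp_const_mul]
    _ ≤ c₁ * (N * pL) + c₂ * (N * pL * (n * (pT + (pL + n * pT) ^ 2))) +
          c₃ * (N * (pL + n * pT)) := by
        gcongr
        · exact sugmExp_linkCount_sub_sq_le
        · exact sugmExp_absorbedCount_le hT hL
        · exact sugmExp_supportedCount_le hT hL
    _ = _ := by
        rw [hc₁, hc₂, hc₃]
        field_simp

end Graph

/-- In the links-and-triangles SUGM, under relative sparsity and
growth (`n^{3/2} p_T^n → 0`, `n^{1/2} p_L^n → 0`, `(p_L^n)³/p_T^n → 0`,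
`binom(n,3)·p_T^n → ∞`, `n²·p_L^n → ∞`), the direct count estimator
`p̂_L^n = S_U(g)/(binom(n,2) − L_T(g))` is ratio consistent:
`p̂_L^n/p_L^n → 1` in probability. -/
theorem stmt_19 (pT pL : ℕ → ℝ)
    (hpT : ∀ n, pT n ∈ Set.Ioo (0 : ℝ) 1) (hpL : ∀ n, pL n ∈ Set.Ioo (0 : ℝ) 1)
    (h1 : Tendsto (fun n : ℕ => (n : ℝ) ^ ((3 : ℝ) / 2) * pT n) atTop (nhds 0))
    (h2 : Tendsto (fun n : ℕ => (n : ℝ) ^ ((1 : ℝ) / 2) * pL n) atTop (nhds 0))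
    (h3 : Tendsto (fun n : ℕ => pL n ^ 3 / pT n) atTop (nhds 0))
    (h4 : Tendsto (fun n : ℕ => (n.choose 3 : ℝ) * pT n) atTop atTop)
    (h5 : Tendsto (fun n : ℕ => (n : ℝ) ^ 2 * pL n) atTop atTop) :
    ∀ ε : ℝ, 0 < ε →
      Tendsto (fun n : ℕ => ∑ ω : SugmOmega n,
          Set.indicator {ω' : SugmOmega n |
              ε < |((unsupportedCount n ω' : ℝ) /
                    ((n.choose 2 : ℝ) - (supportedCount n ω' : ℝ))) / pL n - 1|}
            (sugmWt n (pT n) (pL n)) ω)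
        atTop (nhds 0) := by
  intro ε hε
  set δ : ℝ := min ε 1 / 4 with hδdef
  have hδ : 0 < δ := by positivity
  have hδ' : δ ≤ 1 / 4 := by rw [hδdef]; linarith [min_le_right ε 1]
  have hδε : 4 * δ ≤ ε := by rw [hδdef]; linarith [min_le_left ε 1]
  set u : ℕ → ℝ := fun n => (n : ℝ) ^ ((3 : ℝ) / 2) * pT n with hu
  set v : ℕ → ℝ := fun n => (n : ℝ) ^ ((1 : ℝ) / 2) * pL n with hv
  have hlim : Tendsto (fun n : ℕ => 4 * (δ ^ 2)⁻¹ * ((n : ℝ) ^ 2 * pL n)⁻¹ +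
      δ⁻¹ * (u n + (v n + u n) ^ 2) + δ⁻¹ * (v n + u n)) atTop (nhds 0) := by
    have := ((h5.inv_tendsto_atTop.const_mul (4 * (δ ^ 2)⁻¹)).add
      ((h1.add ((h2.add h1).pow 2)).const_mul δ⁻¹)).add ((h2.add h1).const_mul δ⁻¹)
    simpa using this
  refine squeeze_zero' (Eventually.of_forall fun n => ?_) ?_ hlim
  · exact Finset.sum_nonneg fun ω _ =>
      Set.indicator_nonneg (fun ω _ => sugmWt_nonneg (hpT n) (hpL n) ω) ω
  · filter_upwards [eventually_ge_atTop 2] with n hn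
    refine (sugm_deviation_le (hpT n) (hpL n) hn hδ hδ' hδε).trans ?_
    have hT := (hpT n).1
    have hL := (hpL n).1
    have hn2 : (2 : ℝ) ≤ n := by exact_mod_cast hn
    have hn0 : (0 : ℝ) < n := by linarith
    set s : ℝ := (n : ℝ) ^ ((1 : ℝ) / 2) with hs
    have hs1 : 1 ≤ s := Real.one_le_rpow (by linarith) (by norm_num)
    have hss : s * s = n := by
      rw [hs, ← Real.rpow_add hn0]; norm_num
    have hu' : u n = n * s * pT n := by
      simp only [hu, hs]
      rw [show ((3 : ℝ) / 2) = 1 + 1 / 2 by norm_num, Real.rpow_add hn0, Real.rpow_one]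
    have hv' : v n = s * pL n := rfl
    have hut : n * pT n ≤ u n := by
      rw [hu', mul_right_comm]
      exact le_mul_of_one_le_right (by positivity) hs1
    have hvp : pL n ≤ v n := le_mul_of_one_le_left hL.le hs1
    have hsq : n * (pL n + n * pT n) ^ 2 = (v n + u n) ^ 2 := by
      rw [hu', hv', ← hss]; ring
    have hchoose : (n : ℝ) ^ 2 / 4 ≤ n.choose 2 := by
      rw [Nat.cast_choose_two]; nlinarith
    have hfirst : (δ ^ 2 * (n.choose 2 * pL n))⁻¹ ≤
        4 * (δ ^ 2)⁻¹ * ((n : ℝ) ^ 2 * pL n)⁻¹ := by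
      calc _ ≤ (δ ^ 2 * ((n : ℝ) ^ 2 / 4 * pL n))⁻¹ := by gcongr
        _ = _ := by field_simp
    rw [mul_add (n : ℝ), hsq]
    gcongr
end
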